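/- Let G be a Garside group and let x = Δ^p x₁⋯x_r ∈ G be written in left normal form. If there is an atom a such that τ^p(a) is not a left divisor (prefix) of x₁⋯x_r·a, then c_L(τ⁻¹(a⁻¹xa)) = x. -/

import Mathlib

/-!
Axiomatization of Garside groups (positive cone, Garside element, lattice
structure, left/right normal forms), following the paper
"On the cycling operation in braid groups" by Gebhardt and González-Meneses.
-/

namespace Garside

variable {G : Type*} [Group G]

/-- `a ≼ b`: `a` is a left divisor (prefix) of `b` w.r.t. the positive cone `P`. -/
def LeftDvd (P : Submonoid G) (a b : G) : Prop := a⁻¹ * b ∈ P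

/-- `a` is a right divisor (suffix) of `b` w.r.t. the positive cone `P`
(i.e. `b ≽ a` in the notation of the paper). -/
def RightDvd (P : Submonoid G) (a b : G) : Prop := b * a⁻¹ ∈ P

/-- A simple element: a positive prefix of `Δ`. -/
def Simple (P : Submonoid G) (Δ : G) (s : G) : Prop := s ∈ P ∧ LeftDvd P s Δ

/-- An atom: a nontrivial positive element which is not the product
of two nontrivial positive elements. -/
def Atom (P : Submonoid G) (a : G) : Prop :=
  a ∈ P ∧ a ≠ 1 ∧ ∀ b c : G, b ∈ P → c ∈ P → a = b * c → b = 1 ∨ c = 1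

/-- `Δ^p x₁ ⋯ x_r` (with `l = [x₁,…,x_r]`) is the left normal form of `x`:
each factor is a proper simple element and consecutive factors are
left-weighted, `x_i = (x_i x_{i+1}) ∧_L Δ`. -/
def IsLeftNF (P : Submonoid G) (Δ : G) (gcdL : G → G → G) (p : ℤ) (l : List G) (x : G) :
    Prop :=
  x = Δ ^ p * l.prod ∧ (∀ s ∈ l, Simple P Δ s ∧ s ≠ 1 ∧ s ≠ Δ) ∧
    l.Chain' (fun s t => gcdL (s * t) Δ = s)

/-- `y₁ ⋯ y_r Δ^p` (with `l = [y₁,…,y_r]`) is the right normal form of `x`: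
each factor is a proper simple element and consecutive factors are
right-weighted, `y_{i+1} = (y_i y_{i+1}) ∧_R Δ`. -/
def IsRightNF (P : Submonoid G) (Δ : G) (gcdR : G → G → G) (p : ℤ) (l : List G) (x : G) :
    Prop :=
  x = l.prod * Δ ^ p ∧ (∀ s ∈ l, Simple P Δ s ∧ s ≠ 1 ∧ s ≠ Δ) ∧
    l.Chain' (fun s t => gcdR (s * t) Δ = t)

/-- A Garside structure on a group `G`: a positive cone which induces lattice
orders by left and right divisibility, and a Garside element `Δ` whose left and
right divisors coincide (the simple elements), generate the group, and such that
every element admits a unique left and right normal form. -/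
structure GarsideGroup (G : Type*) [Group G] where
  pos : Submonoid G
  pos_antisymm : ∀ a : G, a ∈ pos → a⁻¹ ∈ pos → a = 1
  Δ : G
  Δ_pos : Δ ∈ pos
  gcdL : G → G → G
  gcdL_dvd_left : ∀ a b : G, LeftDvd pos (gcdL a b) a
  gcdL_dvd_right : ∀ a b : G, LeftDvd pos (gcdL a b) b
  dvd_gcdL : ∀ a b c : G, LeftDvd pos c a → LeftDvd pos c b → LeftDvd pos c (gcdL a b)
  lcmL : G → G → G
  dvd_lcmL_left : ∀ a b : G, LeftDvd pos a (lcmL a b)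
  dvd_lcmL_right : ∀ a b : G, LeftDvd pos b (lcmL a b)
  lcmL_dvd : ∀ a b c : G, LeftDvd pos a c → LeftDvd pos b c → LeftDvd pos (lcmL a b) c
  gcdR : G → G → G
  gcdR_dvd_left : ∀ a b : G, RightDvd pos (gcdR a b) a
  gcdR_dvd_right : ∀ a b : G, RightDvd pos (gcdR a b) b
  dvd_gcdR : ∀ a b c : G, RightDvd pos c a → RightDvd pos c b → RightDvd pos c (gcdR a b)
  lcmR : G → G → G
  dvd_lcmR_left : ∀ a b : G, RightDvd pos a (lcmR a b)
  dvd_lcmR_right : ∀ a b : G, RightDvd pos b (lcmR a b)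
  lcmR_dvd : ∀ a b c : G, RightDvd pos a c → RightDvd pos b c → RightDvd pos (lcmR a b) c
  divisors_Δ : ∀ s : G, (s ∈ pos ∧ LeftDvd pos s Δ) ↔ (s ∈ pos ∧ RightDvd pos s Δ)
  simples_generate : Subgroup.closure {s : G | Simple pos Δ s} = ⊤
  lnf_exists : ∀ x : G, ∃ pl : ℤ × List G, IsLeftNF pos Δ gcdL pl.1 pl.2 x
  lnf_unique : ∀ (x : G) (p q : ℤ) (l m : List G),
    IsLeftNF pos Δ gcdL p l x → IsLeftNF pos Δ gcdL q m x → p = q ∧ l = m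
  rnf_exists : ∀ x : G, ∃ pl : ℤ × List G, IsRightNF pos Δ gcdR pl.1 pl.2 x
  rnf_unique : ∀ (x : G) (p q : ℤ) (l m : List G),
    IsRightNF pos Δ gcdR p l x → IsRightNF pos Δ gcdR q m x → p = q ∧ l = m
  lnf_rnf_agree : ∀ (x : G) (p q : ℤ) (l m : List G),
    IsLeftNF pos Δ gcdL p l x → IsRightNF pos Δ gcdR q m x → p = q ∧ l.length = m.length

/-- `L` is the left lcm of the set `S`. -/
def IsLcmL (P : Submonoid G) (S : Set G) (L : G) : Prop :=
  (∀ a ∈ S, LeftDvd P a L) ∧ ∀ c : G, (∀ a ∈ S, LeftDvd P a c) → LeftDvd P L c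

/-- A Garside group is atom-friendly (on the left) if `Δ` is the left lcm of the
set of atoms and the starting set of the left lcm of any set `B` of atoms is `B`. -/
def AtomFriendlyL (𝒢 : GarsideGroup G) : Prop :=
  IsLcmL 𝒢.pos {a : G | Atom 𝒢.pos a} 𝒢.Δ ∧
    ∀ B : Set G, B ⊆ {a : G | Atom 𝒢.pos a} →
      ∃ L : G, IsLcmL 𝒢.pos B L ∧ {a : G | Atom 𝒢.pos a ∧ LeftDvd 𝒢.pos a L} = B

namespace GarsideGroup

variable (𝒢 : GarsideGroup G)

/-- The left normal form of `x`, as a pair (infimum, list of factors). -/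
noncomputable def lnf (x : G) : ℤ × List G := Classical.choose (𝒢.lnf_exists x)

/-- The right normal form of `x`, as a pair (exponent of `Δ`, list of factors). -/
noncomputable def rnf (x : G) : ℤ × List G := Classical.choose (𝒢.rnf_exists x)

/-- `inf x = p`, the maximal `p` with `Δ^p ≼ x`. -/
noncomputable def inf (x : G) : ℤ := (𝒢.lnf x).1

/-- The canonical length `ℓ(x) = r`. -/
noncomputable def len (x : G) : ℕ := (𝒢.lnf x).2.length

/-- `sup x = p + r`. -/
noncomputable def sup (x : G) : ℤ := 𝒢.inf x + 𝒢.len x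

/-- `tau 𝒢 k x = τ^k(x) = Δ^{-k} x Δ^k`. -/
def tau (k : ℤ) (x : G) : G := 𝒢.Δ ^ (-k) * x * 𝒢.Δ ^ k

/-- The left initial factor `ι_L(x) = τ^{-p}(x₁)` (equal to `1` if `ℓ(x) = 0`). -/
noncomputable def iotaL (x : G) : G := 𝒢.tau (-(𝒢.lnf x).1) ((𝒢.lnf x).2.headD 1)

/-- The right initial factor `ι_R(x) = τ^{p}(y_r)` (equal to `1` if `ℓ(x) = 0`). -/
noncomputable def iotaR (x : G) : G := 𝒢.tau (𝒢.rnf x).1 (((𝒢.rnf x).2.getLast?).getD 1)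

/-- Left cycling: `c_L(x) = ι_L(x)⁻¹ · x · ι_L(x)`. -/
noncomputable def cL (x : G) : G := (𝒢.iotaL x)⁻¹ * x * 𝒢.iotaL x

/-- Right cycling: `c_R(x) = ι_R(x) · x · ι_R(x)⁻¹`. -/
noncomputable def cR (x : G) : G := 𝒢.iotaR x * x * (𝒢.iotaR x)⁻¹

/-- `x = Δ^p x₁⋯x_r` (in left normal form, `r > 0`) is left rigid if
`Δ^p x₁⋯x_r ι_L(x)` is in left normal form as written. -/
def LeftRigid (x : G) : Prop :=
  (𝒢.lnf x).2 ≠ [] ∧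
    IsLeftNF 𝒢.pos 𝒢.Δ 𝒢.gcdL (𝒢.lnf x).1 ((𝒢.lnf x).2 ++ [𝒢.iotaL x]) (x * 𝒢.iotaL x)

/-- `x = y₁⋯y_r Δ^p` (in right normal form, `r > 0`) is right rigid if
`ι_R(x) y₁⋯y_r Δ^p` is in right normal form as written. -/
def RightRigid (x : G) : Prop :=
  (𝒢.rnf x).2 ≠ [] ∧
    IsRightNF 𝒢.pos 𝒢.Δ 𝒢.gcdR (𝒢.rnf x).1 (𝒢.iotaR x :: (𝒢.rnf x).2) (𝒢.iotaR x * x)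

/-- The super summit set: conjugates of minimal canonical length. -/
def SSS (x : G) : Set G :=
  {y | IsConj x y ∧ ∀ z : G, IsConj x z → 𝒢.len y ≤ 𝒢.len z}

/-- The left ultra summit set. -/
def USSL (x : G) : Set G :=
  {y ∈ 𝒢.SSS x | ∃ t : ℕ, 1 ≤ t ∧ (𝒢.cL)^[t] y = y}

/-- The right ultra summit set. -/
def USSR (x : G) : Set G :=
  {y ∈ 𝒢.SSS x | ∃ t : ℕ, 1 ≤ t ∧ (𝒢.cR)^[t] y = y}

/-- `x` is periodically geodesic: `inf(x^m) = m inf(x)` and `sup(x^m) = m sup(x)`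
for all `m ≥ 1`. -/
def PeriodicallyGeodesic (x : G) : Prop :=
  ∀ m : ℕ, 1 ≤ m → 𝒢.inf (x ^ m) = (m : ℤ) * 𝒢.inf x ∧ 𝒢.sup (x ^ m) = (m : ℤ) * 𝒢.sup x

/-- The left interior `x°_L = x Δ^{-p}`, where `p = inf(x)`. -/
noncomputable def intL (x : G) : G := x * 𝒢.Δ ^ (-𝒢.inf x)

/-- The right interior `x°_R = Δ^{-p} x`, where `p = inf(x)`. -/
noncomputable def intR (x : G) : G := 𝒢.Δ ^ (-𝒢.inf x) * x

/-- The right transport of `v` (where `v x v⁻¹ = z`):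
`v^{(1)}_R = ι_R(z) · v · ι_R(x)⁻¹`. -/
noncomputable def transR (x v : G) : G := 𝒢.iotaR (v * x * v⁻¹) * v * (𝒢.iotaR x)⁻¹

/-- The iterated right transport `v^{(i)}_R` of `v` along the right cyclings of `x`. -/
noncomputable def transRIter (x : G) : ℕ → G → G
  | 0, v => v
  | i + 1, v => 𝒢.transR ((𝒢.cR)^[i] x) (transRIter x i v)

/-- Arrows of the left ultra summit graph `USG_L(x)`: triples `(u, s, v)` with
`u, v ∈ USS_L(x)`, `s` simple and `s⁻¹ u s = v`. -/
def ArrL (x : G) : Set (G × G × G) :=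
  {a | a.1 ∈ 𝒢.USSL x ∧ a.2.2 ∈ 𝒢.USSL x ∧ Simple 𝒢.pos 𝒢.Δ a.2.1 ∧
    a.2.1⁻¹ * a.1 * a.2.1 = a.2.2}

/-- Arrows of the right ultra summit graph `USG_R(x)`: triples `(u, s, v)` with
`u, v ∈ USS_R(x)`, `s` simple and `s u s⁻¹ = v`. -/
def ArrR (x : G) : Set (G × G × G) :=
  {a | a.1 ∈ 𝒢.USSR x ∧ a.2.2 ∈ 𝒢.USSR x ∧ Simple 𝒢.pos 𝒢.Δ a.2.1 ∧
    a.2.1 * a.1 * a.2.1⁻¹ = a.2.2}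

/-- `PathFrom A u l`: the list of arrows `l` forms a directed path in the
graph with arrow set `A`, starting at the vertex `u`. -/
def PathFrom (A : Set (G × G × G)) : G → List (G × G × G) → Prop
  | _, [] => True
  | u, a :: rest => a ∈ A ∧ a.1 = u ∧ PathFrom A a.2.2 rest

/-- Minimal arrows of `USG_L(x)`: arrows whose label is not a product of the
labels of a directed path of length at least 2 starting at the same vertex. -/
def MinArrL (x : G) : Set (G × G × G) :=
  {a | a ∈ 𝒢.ArrL x ∧ ¬ ∃ l : List (G × G × G), 2 ≤ l.length ∧
    PathFrom (𝒢.ArrL x) a.1 l ∧ (l.map (fun b => b.2.1)).prod = a.2.1}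

/-- Minimal arrows of `USG_R(x)`. -/
def MinArrR (x : G) : Set (G × G × G) :=
  {a | a ∈ 𝒢.ArrR x ∧ ¬ ∃ l : List (G × G × G), 2 ≤ l.length ∧
    PathFrom (𝒢.ArrR x) a.1 l ∧ (l.map (fun b => b.2.1)).prod = a.2.1}

end GarsideGroup

end Garside


namespace Garside

section helpers

variable {G : Type*} [Group G] (𝒢 : GarsideGroup G)

theorem dvd_antisymm' {a b : G} (h1 : LeftDvd 𝒢.pos a b) (h2 : LeftDvd 𝒢.pos b a) : a = b := by
  have h := 𝒢.pos_antisymm (a⁻¹ * b) h1 (by simpa [LeftDvd] using h2)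
  exact (inv_mul_eq_one.mp h)

theorem Delta_ne_one : 𝒢.Δ ≠ 1 := by
  intro h
  obtain ⟨⟨q, m⟩, h1⟩ := 𝒢.lnf_exists 1
  have h2 : IsLeftNF 𝒢.pos 𝒢.Δ 𝒢.gcdL (q + 1) m 1 := by
    refine ⟨?_, h1.2⟩
    have := h1.1
    simpa [h] using this
  have := (𝒢.lnf_unique 1 q (q + 1) m m h1 h2).1
  omega

theorem simple_right {s : G} (h : Simple 𝒢.pos 𝒢.Δ s) : 𝒢.Δ * s⁻¹ ∈ 𝒢.pos :=
  ((𝒢.divisors_Δ s).mp h).2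

theorem simple_of_right {s : G} (h : s ∈ 𝒢.pos) (h' : 𝒢.Δ * s⁻¹ ∈ 𝒢.pos) :
    Simple 𝒢.pos 𝒢.Δ s := (𝒢.divisors_Δ s).mpr ⟨h, h'⟩

theorem simple_compl {s : G} (h : Simple 𝒢.pos 𝒢.Δ s) : Simple 𝒢.pos 𝒢.Δ (s⁻¹ * 𝒢.Δ) := by
  refine simple_of_right 𝒢 h.2 ?_
  simpa using h.1

theorem simple_compl' {s : G} (h : Simple 𝒢.pos 𝒢.Δ s) : Simple 𝒢.pos 𝒢.Δ (𝒢.Δ * s⁻¹) := by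
  refine ⟨simple_right 𝒢 h, ?_⟩
  simpa [LeftDvd] using h.1

theorem prod_pos {m : List G} (h : ∀ s ∈ m, Simple 𝒢.pos 𝒢.Δ s ∧ s ≠ 1 ∧ s ≠ 𝒢.Δ) :
    m.prod ∈ 𝒢.pos := Submonoid.list_prod_mem _ (fun s hs => (h s hs).1.1)

/-- Local left-weightedness implies the global one. -/
theorem gcd_head (u : List G) : ∀ s : G,
    (∀ v ∈ s :: u, Simple 𝒢.pos 𝒢.Δ v ∧ v ≠ 1 ∧ v ≠ 𝒢.Δ) →
    (s :: u).IsChain (fun s t => 𝒢.gcdL (s * t) 𝒢.Δ = s) →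
    𝒢.gcdL (s * u.prod) 𝒢.Δ = s := by
  induction u with
  | nil =>
    intro s hs _
    have hs' := (hs s (by simp)).1
    refine dvd_antisymm' 𝒢 ?_ (𝒢.dvd_gcdL _ _ _ ?_ hs'.2)
    · simpa using 𝒢.gcdL_dvd_left (s * ([] : List G).prod) 𝒢.Δ
    · simp [LeftDvd]
  | cons t u ih =>
    intro s hs hc
    rw [List.isChain_cons_cons] at hc
    have hs' := (hs s (by simp)).1
    have hu := prod_pos 𝒢 (m := t :: u) (fun v hv => hs v (List.mem_cons_of_mem _ hv))
    have iht := ih t (fun v hv => hs v (List.mem_cons_of_mem _ hv)) hc.2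
    set g := 𝒢.gcdL (s * (t :: u).prod) 𝒢.Δ with hg
    have g1 : LeftDvd 𝒢.pos g (s * (t :: u).prod) := 𝒢.gcdL_dvd_left _ _
    have g2 : LeftDvd 𝒢.pos g 𝒢.Δ := 𝒢.gcdL_dvd_right _ _
    have hsg : LeftDvd 𝒢.pos s g := 𝒢.dvd_gcdL _ _ _ (by simpa [LeftDvd] using hu) hs'.2
    have e1 : LeftDvd 𝒢.pos (s⁻¹ * g) (t * u.prod) := by
      simpa [LeftDvd, mul_assoc] using g1
    have e2 : LeftDvd 𝒢.pos (s⁻¹ * g) 𝒢.Δ := by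
      have k1 : s⁻¹ * 𝒢.Δ = (s⁻¹ * g) * (g⁻¹ * 𝒢.Δ) := by group
      have k2 := (simple_compl 𝒢 hs').2
      have k3 : (s⁻¹ * g)⁻¹ * 𝒢.Δ = (g⁻¹ * 𝒢.Δ) * ((s⁻¹ * 𝒢.Δ)⁻¹ * 𝒢.Δ) := by group
      rw [LeftDvd, k3]
      exact 𝒢.pos.mul_mem g2 k2
    have e3 : LeftDvd 𝒢.pos (s⁻¹ * g) t := by
      rw [← iht]; exact 𝒢.dvd_gcdL _ _ _ e1 e2
    have e4 : LeftDvd 𝒢.pos g (s * t) := by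
      simpa [LeftDvd, mul_assoc] using e3
    have e5 : LeftDvd 𝒢.pos g s := by
      have := 𝒢.dvd_gcdL _ _ _ e4 g2
      rwa [hc.1] at this
    exact dvd_antisymm' 𝒢 e5 hsg

theorem not_Delta_dvd {m : List G}
    (h : ∀ v ∈ m, Simple 𝒢.pos 𝒢.Δ v ∧ v ≠ 1 ∧ v ≠ 𝒢.Δ)
    (hc : m.IsChain (fun s t => 𝒢.gcdL (s * t) 𝒢.Δ = s)) :
    ¬ LeftDvd 𝒢.pos 𝒢.Δ m.prod := by
  intro hd
  cases m with
  | nil =>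
    have := 𝒢.pos_antisymm 𝒢.Δ 𝒢.Δ_pos (by simpa [LeftDvd] using hd)
    exact Delta_ne_one 𝒢 this
  | cons s u =>
    have h1 := gcd_head 𝒢 u s h hc
    have h2 := 𝒢.dvd_gcdL _ 𝒢.Δ 𝒢.Δ (by simpa using hd) (by simp [LeftDvd])
    rw [h1] at h2
    have h3 := h s (by simp)
    exact h3.2.2 (dvd_antisymm' 𝒢 h3.1.2 h2)

theorem inf_nonneg {w : G} (hw : w ∈ 𝒢.pos) {q : ℤ} {m : List G}
    (h : IsLeftNF 𝒢.pos 𝒢.Δ 𝒢.gcdL q m w) : 0 ≤ q := by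
  by_contra hq
  apply not_Delta_dvd 𝒢 h.2.1 h.2.2
  obtain ⟨n, hn⟩ := Int.eq_ofNat_of_zero_le (show 0 ≤ -q - 1 by omega)
  have hm : 𝒢.Δ⁻¹ * m.prod = 𝒢.Δ ^ n * w := by
    rw [h.1, ← zpow_natCast, ← hn]; group
  rw [LeftDvd, hm]
  exact 𝒢.pos.mul_mem (𝒢.pos.pow_mem 𝒢.Δ_pos n) hw

theorem pos_decomp {w : G} (hw : w ∈ 𝒢.pos) : ∃ (n : ℕ) (m : List G),
    IsLeftNF 𝒢.pos 𝒢.Δ 𝒢.gcdL n m w := by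
  obtain ⟨⟨q, m⟩, h⟩ := 𝒢.lnf_exists w
  obtain ⟨n, rfl⟩ := Int.eq_ofNat_of_zero_le (inf_nonneg 𝒢 hw h)
  exact ⟨n, m, h⟩

theorem tau_mul (k : ℤ) (x y : G) : 𝒢.tau k (x * y) = 𝒢.tau k x * 𝒢.tau k y := by
  simp [GarsideGroup.tau, mul_assoc]

theorem tau_one (k : ℤ) : 𝒢.tau k 1 = 1 := by simp [GarsideGroup.tau]

theorem tau_inv (k : ℤ) (x : G) : 𝒢.tau k x⁻¹ = (𝒢.tau k x)⁻¹ := by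
  simp [GarsideGroup.tau, mul_assoc]

theorem tau_tau (j k : ℤ) (x : G) : 𝒢.tau j (𝒢.tau k x) = 𝒢.tau (j + k) x := by
  simp only [GarsideGroup.tau]; group

theorem tau_zero (x : G) : 𝒢.tau 0 x = x := by simp [GarsideGroup.tau]

theorem tau_Delta (k : ℤ) : 𝒢.tau k 𝒢.Δ = 𝒢.Δ := by
  simp only [GarsideGroup.tau]; group

theorem tau_pos_of_simple (k : ℤ)
    (H : ∀ s, Simple 𝒢.pos 𝒢.Δ s → 𝒢.tau k s ∈ 𝒢.pos) {w : G} (hw : w ∈ 𝒢.pos) :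
    𝒢.tau k w ∈ 𝒢.pos := by
  obtain ⟨n, m, h⟩ := pos_decomp 𝒢 hw
  have hm : ∀ m : List G, (∀ s ∈ m, Simple 𝒢.pos 𝒢.Δ s ∧ s ≠ 1 ∧ s ≠ 𝒢.Δ) →
      𝒢.tau k m.prod ∈ 𝒢.pos := by
    intro m
    induction m with
    | nil => intro _; simp [tau_one]
    | cons s u ih =>
      intro hs
      rw [List.prod_cons, tau_mul]
      exact 𝒢.pos.mul_mem (H s (hs s (by simp)).1)
        (ih (fun v hv => hs v (List.mem_cons_of_mem _ hv)))
  have e : 𝒢.tau k (𝒢.Δ ^ (n : ℤ)) = 𝒢.Δ ^ n := by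
    rw [← zpow_natCast]; simp only [GarsideGroup.tau]; group
  rw [h.1, tau_mul, e]
  exact 𝒢.pos.mul_mem (𝒢.pos.pow_mem 𝒢.Δ_pos n) (hm m h.2.1)

theorem tau_one_pos {w : G} (hw : w ∈ 𝒢.pos) : 𝒢.tau 1 w ∈ 𝒢.pos := by
  refine tau_pos_of_simple 𝒢 1 (fun s hs => ?_) hw
  have := (simple_compl 𝒢 (simple_compl 𝒢 hs)).1
  simpa [GarsideGroup.tau, mul_assoc] using this

theorem tau_neg_one_pos {w : G} (hw : w ∈ 𝒢.pos) : 𝒢.tau (-1) w ∈ 𝒢.pos := by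
  refine tau_pos_of_simple 𝒢 (-1) (fun s hs => ?_) hw
  have := (simple_compl' 𝒢 (simple_compl' 𝒢 hs)).1
  simpa [GarsideGroup.tau, mul_assoc] using this

theorem tau_pos (k : ℤ) {w : G} (hw : w ∈ 𝒢.pos) : 𝒢.tau k w ∈ 𝒢.pos := by
  induction k using Int.induction_on with
  | zero => rwa [tau_zero]
  | succ i ih =>
    rw [add_comm, ← tau_tau]; exact tau_one_pos 𝒢 ih
  | pred i ih =>
    rw [sub_eq_add_neg, add_comm, ← tau_tau]; exact tau_neg_one_pos 𝒢 ih

theorem atom_simple {a : G} (ha : Atom 𝒢.pos a) : Simple 𝒢.pos 𝒢.Δ a := by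
  obtain ⟨ha1, ha2, ha3⟩ := ha
  obtain ⟨n, m, h⟩ := pos_decomp 𝒢 ha1
  have hm := prod_pos 𝒢 h.2.1
  cases n with
  | zero =>
    cases m with
    | nil => exact absurd (by simpa using h.1) ha2
    | cons b u =>
      have hb := h.2.1 b (by simp)
      have hu := prod_pos 𝒢 (m := u) (fun v hv => h.2.1 v (List.mem_cons_of_mem _ hv))
      have e : a = b * u.prod := by simpa using h.1
      rcases ha3 b u.prod hb.1.1 hu e with h1 | h1
      · exact absurd h1 hb.2.1
      · rw [e, h1, mul_one]; exact hb.1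
  | succ n =>
    have e : a = 𝒢.Δ * (𝒢.Δ ^ n * m.prod) := by
      rw [← mul_assoc, ← pow_succ', ← zpow_natCast]; exact h.1
    rcases ha3 _ _ 𝒢.Δ_pos (𝒢.pos.mul_mem (𝒢.pos.pow_mem 𝒢.Δ_pos n) hm) e with h1 | h1
    · exact absurd h1 (Delta_ne_one 𝒢)
    · rw [e, h1, mul_one]; exact ⟨𝒢.Δ_pos, by simp [LeftDvd]⟩

/-- If `t = (t w') ∧ Δ` is a proper simple element, then `Δ^k t w'` has normal form
with exponent `k` and first factor `t`. -/
theorem nf_of_gcd (k : ℤ) {t w : G} (ht : Simple 𝒢.pos 𝒢.Δ t) (ht1 : t ≠ 1)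
    (htD : t ≠ 𝒢.Δ) (hw : w ∈ 𝒢.pos)
    (hg : ∀ d, LeftDvd 𝒢.pos d (t * w) → LeftDvd 𝒢.pos d 𝒢.Δ → LeftDvd 𝒢.pos d t) :
    ∃ m, IsLeftNF 𝒢.pos 𝒢.Δ 𝒢.gcdL k (t :: m) (𝒢.Δ ^ k * (t * w)) := by
  obtain ⟨n, m, h⟩ := pos_decomp 𝒢 hw
  have hm := prod_pos 𝒢 h.2.1
  cases n with
  | succ n =>
    exfalso
    have e : w = 𝒢.Δ * (𝒢.Δ ^ n * m.prod) := by
      rw [← mul_assoc, ← pow_succ', ← zpow_natCast]; exact h.1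
    have hd : LeftDvd 𝒢.pos 𝒢.Δ (t * w) := by
      have e2 : 𝒢.Δ⁻¹ * (t * w) = 𝒢.tau 1 t * (𝒢.Δ ^ n * m.prod) := by
        rw [e]; simp [GarsideGroup.tau, mul_assoc]
      rw [LeftDvd, e2]
      exact 𝒢.pos.mul_mem (tau_pos 𝒢 1 ht.1)
        (𝒢.pos.mul_mem (𝒢.pos.pow_mem 𝒢.Δ_pos n) hm)
    exact htD (dvd_antisymm' 𝒢 ht.2 (hg _ hd (by simp [LeftDvd])))
  | zero =>
    have e : w = m.prod := by simpa using h.1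
    refine ⟨m, by rw [e, List.prod_cons], ?_, ?_⟩
    · intro s hs
      rcases List.mem_cons.mp hs with rfl | hs
      · exact ⟨ht, ht1, htD⟩
      · exact h.2.1 s hs
    · change List.IsChain _ (t :: m)
      cases m with
      | nil => simp
      | cons b u =>
        rw [List.isChain_cons_cons]
        refine ⟨?_, h.2.2⟩
        have hb := (h.2.1 b (by simp)).1
        have hu := prod_pos 𝒢 (m := u) (fun v hv => h.2.1 v (List.mem_cons_of_mem _ hv))
        refine dvd_antisymm' 𝒢 (hg _ ?_ (𝒢.gcdL_dvd_right _ _)) (𝒢.dvd_gcdL _ _ _ ?_ ht.2)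
        · have := 𝒢.pos.mul_mem (𝒢.gcdL_dvd_left (t * b) 𝒢.Δ) hu
          simpa [LeftDvd, e, mul_assoc] using this
        · simpa [LeftDvd] using hb.1

theorem iotaL_eq {y : G} {q : ℤ} {t : G} {m : List G}
    (h : IsLeftNF 𝒢.pos 𝒢.Δ 𝒢.gcdL q (t :: m) y) : 𝒢.iotaL y = 𝒢.tau (-q) t := by
  have h0 : IsLeftNF 𝒢.pos 𝒢.Δ 𝒢.gcdL (𝒢.lnf y).1 (𝒢.lnf y).2 y :=
    Classical.choose_spec (𝒢.lnf_exists y)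
  obtain ⟨h1, h2⟩ := 𝒢.lnf_unique _ _ _ _ _ h0 h
  simp [GarsideGroup.iotaL, h1, h2]

end helpers

/-- **Proposition 3.1.** Let `G` be a Garside group and let `x = Δ^p x₁⋯x_r ∈ G`
be written in left normal form. If there is an atom `a` such that
`τ^p(a)` is not a prefix of `x₁⋯x_r a`, then `c_L(τ⁻¹(a⁻¹ x a)) = x`. -/
theorem cL_preimage_of_atom {G : Type*} [Group G] (𝒢 : GarsideGroup G)
    (x : G) (p : ℤ) (l : List G) (hx : IsLeftNF 𝒢.pos 𝒢.Δ 𝒢.gcdL p l x)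
    (a : G) (ha : Atom 𝒢.pos a)
    (hnd : ¬ LeftDvd 𝒢.pos (𝒢.tau p a) (l.prod * a)) :
    𝒢.cL (𝒢.tau (-1) (a⁻¹ * x * a)) = x := by
  have has := atom_simple 𝒢 ha
  have hl := prod_pos 𝒢 hx.2.1
  have haD : a ≠ 𝒢.Δ := by
    intro h
    apply hnd
    have := tau_pos 𝒢 1 hl
    rw [h, tau_Delta]
    simpa [LeftDvd, GarsideGroup.tau, mul_assoc] using this
  have hs := simple_compl' 𝒢 has
  set s := 𝒢.Δ * a⁻¹ with hsdef
  set t := 𝒢.tau (p - 1) s with htdef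
  set b := 𝒢.tau (p - 1) a with hbdef
  have htb : t * b = 𝒢.Δ := by
    rw [htdef, hbdef, ← tau_mul, hsdef, inv_mul_cancel_right, tau_Delta]
  have hb : b ∈ 𝒢.pos := tau_pos 𝒢 _ has.1
  have htS : Simple 𝒢.pos 𝒢.Δ t :=
    ⟨tau_pos 𝒢 _ hs.1, by rw [LeftDvd, ← htb]; simpa using hb⟩
  have hba : 𝒢.tau (-(p - 1)) b = a := by
    rw [hbdef, tau_tau]; simp [tau_zero]
  have ht1 : t ≠ 1 := by
    intro h
    rw [h, one_mul] at htb
    rw [htb, tau_Delta] at hba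
    exact haD hba.symm
  have htD : t ≠ 𝒢.Δ := by
    intro h
    rw [h] at htb
    have hb1 : b = 1 := by simpa using htb
    rw [hb1, tau_one] at hba
    exact ha.2.1 hba.symm
  have hw : 𝒢.tau (-1) (l.prod * a) ∈ 𝒢.pos := tau_pos 𝒢 _ (𝒢.pos.mul_mem hl has.1)
  set w := 𝒢.tau (-1) (l.prod * a) with hwdef
  have hg : ∀ d, LeftDvd 𝒢.pos d (t * w) → LeftDvd 𝒢.pos d 𝒢.Δ → LeftDvd 𝒢.pos d t := by
    intro d hd1 hd2
    have hd := 𝒢.dvd_gcdL _ _ _ hd1 hd2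
    have g1 := 𝒢.gcdL_dvd_left (t * w) 𝒢.Δ
    have g2 := 𝒢.gcdL_dvd_right (t * w) 𝒢.Δ
    have g3 : LeftDvd 𝒢.pos t (𝒢.gcdL (t * w) 𝒢.Δ) :=
      𝒢.dvd_gcdL _ _ _ (by simpa [LeftDvd] using hw) htS.2
    generalize 𝒢.gcdL (t * w) 𝒢.Δ = g at *
    -- `g = t e` with `e` a prefix of `w` and of `b`
    have e2 : (t⁻¹ * g)⁻¹ * b ∈ 𝒢.pos := by
      have : (t⁻¹ * g)⁻¹ * b = g⁻¹ * 𝒢.Δ := by rw [← htb]; group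
      rw [this]; exact g2
    have e1 : (t⁻¹ * g)⁻¹ * w ∈ 𝒢.pos := by
      have : (t⁻¹ * g)⁻¹ * w = g⁻¹ * (t * w) := by group
      rw [this]; exact g1
    have e3 : t⁻¹ * g ∈ 𝒢.pos := g3
    rcases ha.2.2 (𝒢.tau (-(p - 1)) (t⁻¹ * g)) (𝒢.tau (-(p - 1)) ((t⁻¹ * g)⁻¹ * b))
      (tau_pos 𝒢 _ e3) (tau_pos 𝒢 _ e2) (by rw [← tau_mul, mul_inv_cancel_left, hba]) with h | h
    · have h' := congrArg (𝒢.tau (p - 1)) h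
      rw [tau_tau, tau_one, add_neg_cancel, tau_zero] at h'
      rw [inv_mul_eq_one.mp h']; exact hd
    · exfalso
      have h' := congrArg (𝒢.tau (p - 1)) h
      rw [tau_tau, tau_one, add_neg_cancel, tau_zero] at h'
      rw [inv_mul_eq_one.mp h'] at e1
      apply hnd
      have e5 := tau_pos 𝒢 1 e1
      rw [tau_mul, tau_inv, hbdef, hwdef, tau_tau, tau_tau] at e5
      simpa [LeftDvd, tau_zero] using e5
  obtain ⟨m, hm⟩ := nf_of_gcd 𝒢 (p - 1) htS ht1 htD hw hg
  have hy : 𝒢.tau (-1) (a⁻¹ * x * a) = 𝒢.Δ ^ (p - 1) * (t * w) := by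
    rw [hx.1, htdef, hwdef, hsdef]
    simp only [GarsideGroup.tau]
    group
  rw [← hy] at hm
  have hi := iotaL_eq 𝒢 hm
  rw [htdef, tau_tau, neg_add_cancel, tau_zero] at hi
  rw [GarsideGroup.cL, hi, hsdef]
  simp only [GarsideGroup.tau]
  group

end Garside
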